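/- arXiv:math/0611445 — 2 statements merged into one kernel-verified Lean document; each statement's English description precedes it below -/
import Mathlib

section
/- There exists a nonzero polynomial P with integer coefficients in five variables such that for any two continuous functions f, w : ℝ → ℝ with w(x) > 0 for all x ∈ ℝ, there exists an infinitely differentiable function U : ℝ → ℝ satisfying the fourth-order ordinary differential equation P(U(x), U'(x), U''(x), U'''(x), U''''(x)) = 0 for all x ∈ ℝ, and |f(x) − U(x)| ≤ w(x) for all x ∈ ℝ. -/
open Set Filter Topology

/-- Rubel's polynomial, homogeneous of degree seven and independent of the zeroth variable. -/
noncomputable def rubelPolynomial : MvPolynomial (Fin 5) ℤ :=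
  3 * .X 1 ^ 4 * .X 2 * .X 4 ^ 2 - 4 * .X 1 ^ 4 * .X 3 ^ 2 * .X 4
    + 6 * .X 1 ^ 3 * .X 2 ^ 2 * .X 3 * .X 4 + 24 * .X 1 ^ 2 * .X 2 ^ 4 * .X 4
    - 12 * .X 1 ^ 3 * .X 2 * .X 3 ^ 3 - 29 * .X 1 ^ 2 * .X 2 ^ 3 * .X 3 ^ 2 + 12 * .X 2 ^ 7

theorem aeval_rubelPolynomial (v : Fin 5 → ℝ) :
    MvPolynomial.aeval v rubelPolynomial =
      3 * v 1 ^ 4 * v 2 * v 4 ^ 2 - 4 * v 1 ^ 4 * v 3 ^ 2 * v 4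
        + 6 * v 1 ^ 3 * v 2 ^ 2 * v 3 * v 4 + 24 * v 1 ^ 2 * v 2 ^ 4 * v 4
        - 12 * v 1 ^ 3 * v 2 * v 3 ^ 3 - 29 * v 1 ^ 2 * v 2 ^ 3 * v 3 ^ 2 + 12 * v 2 ^ 7 := by
  simp [rubelPolynomial]

theorem rubelPolynomial_ne_zero : rubelPolynomial ≠ 0 := by
  intro h
  have := aeval_rubelPolynomial (Pi.single 2 1)
  simp [h] at this

/-- `U` satisfies Rubel's differential equation at `x`. -/
def SolvesRubelAt (U : ℝ → ℝ) (x : ℝ) : Prop :=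
  MvPolynomial.aeval (fun i : Fin 5 => iteratedDeriv (i : ℕ) U x) rubelPolynomial = 0

theorem solvesRubelAt_iff {U : ℝ → ℝ} {x : ℝ} : SolvesRubelAt U x ↔
    3 * iteratedDeriv 1 U x ^ 4 * iteratedDeriv 2 U x * iteratedDeriv 4 U x ^ 2
      - 4 * iteratedDeriv 1 U x ^ 4 * iteratedDeriv 3 U x ^ 2 * iteratedDeriv 4 U x
      + 6 * iteratedDeriv 1 U x ^ 3 * iteratedDeriv 2 U x ^ 2 * iteratedDeriv 3 U x
        * iteratedDeriv 4 U x
      + 24 * iteratedDeriv 1 U x ^ 2 * iteratedDeriv 2 U x ^ 4 * iteratedDeriv 4 U x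
      - 12 * iteratedDeriv 1 U x ^ 3 * iteratedDeriv 2 U x * iteratedDeriv 3 U x ^ 3
      - 29 * iteratedDeriv 1 U x ^ 2 * iteratedDeriv 2 U x ^ 3 * iteratedDeriv 3 U x ^ 2
      + 12 * iteratedDeriv 2 U x ^ 7 = 0 := by
  rw [SolvesRubelAt, aeval_rubelPolynomial]
  rfl

theorem SolvesRubelAt.congr {U V : ℝ → ℝ} {x : ℝ} (hU : SolvesRubelAt U x)
    (h : ∀ n, iteratedDeriv (n + 1) V x = iteratedDeriv (n + 1) U x) : SolvesRubelAt V x := by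
  rw [solvesRubelAt_iff] at hU ⊢
  rwa [h 0, h 1, h 2, h 3]

theorem SolvesRubelAt.congr_of_eventuallyEq {U V : ℝ → ℝ} {x : ℝ} (hU : SolvesRubelAt U x)
    (h : V =ᶠ[𝓝 x] U) : SolvesRubelAt V x :=
  hU.congr fun n => h.iteratedDeriv_eq (n + 1)

theorem solvesRubelAt_of_iteratedDeriv_eq_zero {U : ℝ → ℝ} {x : ℝ}
    (h : ∀ n, iteratedDeriv (n + 1) U x = 0) : SolvesRubelAt U x := by
  rw [solvesRubelAt_iff, h 0, h 1, h 2, h 3]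
  ring

theorem iteratedDeriv_succ_eq_zero_of_mem_closure {V : ℝ → ℝ} (hV : ContDiff ℝ (⊤ : ℕ∞) V)
    {s : Set ℝ} (hs : IsOpen s) {c : ℝ} (h : ∀ x ∈ s, V x = c) (n : ℕ) {x : ℝ}
    (hx : x ∈ closure s) : iteratedDeriv (n + 1) V x = 0 := by
  have hcont : Continuous (iteratedDeriv (n + 1) V) :=
    hV.continuous_iteratedDeriv (n + 1) (by exact_mod_cast le_top)
  refine closure_minimal (t := {y | iteratedDeriv (n + 1) V y = 0}) (fun y hy => ?_)
    (isClosed_eq hcont continuous_const) hx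
  have hev : V =ᶠ[𝓝 y] fun _ => c := by
    filter_upwards [hs.mem_nhds hy] with z hz using h z hz
  rw [mem_ofPred_eq, hev.iteratedDeriv_eq, iteratedDeriv_const]
  simp

theorem solvesRubelAt_of_hasDerivAt {V D u u₁ u₂ : ℝ → ℝ} {s : Set ℝ} (hs : IsOpen s)
    (hV : ∀ x ∈ s, HasDerivAt V (D x) x) (hD : ∀ x ∈ s, HasDerivAt D (D x * u x) x)
    (hu : ∀ x ∈ s, HasDerivAt u (u₁ x) x) (hu₁ : ∀ x ∈ s, HasDerivAt u₁ (u₂ x) x)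
    {x : ℝ} (hx : x ∈ s)
    (h : 3 * u x * (u x ^ 3 + 3 * u x * u₁ x + u₂ x) ^ 2
      - 4 * (u x ^ 2 + u₁ x) ^ 2 * (u x ^ 3 + 3 * u x * u₁ x + u₂ x)
      + 6 * u x ^ 2 * (u x ^ 2 + u₁ x) * (u x ^ 3 + 3 * u x * u₁ x + u₂ x)
      + 24 * u x ^ 4 * (u x ^ 3 + 3 * u x * u₁ x + u₂ x)
      - 12 * u x * (u x ^ 2 + u₁ x) ^ 3 - 29 * u x ^ 3 * (u x ^ 2 + u₁ x) ^ 2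
      + 12 * u x ^ 7 = 0) : SolvesRubelAt V x := by
  have step : ∀ {n : ℕ} {F F' : ℝ → ℝ}, (∀ y ∈ s, iteratedDeriv n V y = F y) →
      (∀ y ∈ s, HasDerivAt F (F' y) y) → ∀ y ∈ s, iteratedDeriv (n + 1) V y = F' y := by
    intro n F F' hF hF' y hy
    have hev : iteratedDeriv n V =ᶠ[𝓝 y] F := by
      filter_upwards [hs.mem_nhds hy] with z hz using hF z hz
    rw [iteratedDeriv_succ, hev.deriv_eq, (hF' y hy).deriv]
  have h1 := step (n := 0) (F := V) (fun y _ => by simp) hV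
  have h2 := step h1 hD
  have h3 := step (F' := fun y => D y * (u y ^ 2 + u₁ y)) h2 fun y hy =>
    ((hD y hy).mul (hu y hy)).congr_deriv (by ring)
  have h4 := step (F' := fun y => D y * (u y ^ 3 + 3 * u y * u₁ y + u₂ y)) h3 fun y hy =>
    ((hD y hy).mul (((hu y hy).pow 2).add (hu₁ y hy))).congr_deriv (by simp; ring)
  rw [solvesRubelAt_iff, h1 x hx, h2 x hx, h3 x hx, h4 x hx]
  linear_combination D x ^ 7 * h

/-- The bump function `exp (-1 / (1 - t ^ 2))`, supported on `[-1, 1]`. -/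
noncomputable def rubelBump (t : ℝ) : ℝ := expNegInvGlue (1 - t ^ 2)

theorem contDiff_rubelBump : ContDiff ℝ (⊤ : ℕ∞) rubelBump :=
  expNegInvGlue.contDiff.comp (by fun_prop)

theorem rubelBump_eq_zero {t : ℝ} (ht : 1 ≤ t ^ 2) : rubelBump t = 0 :=
  expNegInvGlue.zero_of_nonpos (by linarith)

theorem rubelBump_nonneg (t : ℝ) : 0 ≤ rubelBump t := expNegInvGlue.nonneg _

theorem hasDerivAt_rubelBump {t : ℝ} (ht : t ^ 2 < 1) :
    HasDerivAt rubelBump (rubelBump t * (-2 * t / (1 - t ^ 2) ^ 2)) t := by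
  have hq : 1 - t ^ 2 ≠ 0 := by linarith
  have hopen : IsOpen {s : ℝ | s ^ 2 < 1} := isOpen_lt (by fun_prop) continuous_const
  have hexp : ∀ s : ℝ, s ^ 2 < 1 → rubelBump s = Real.exp (-(1 - s ^ 2)⁻¹) := by
    intro s hs
    rw [rubelBump, expNegInvGlue, if_neg (by linarith)]
  have hev : rubelBump =ᶠ[𝓝 t] fun s => Real.exp (-(1 - s ^ 2)⁻¹) := by
    filter_upwards [hopen.mem_nhds ht] with s hs using hexp s hs
  rw [hev.hasDerivAt_iff, hexp t ht]
  have h := (((((hasDerivAt_id t).pow 2).const_sub 1).inv hq).neg).exp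
  refine h.congr_deriv ?_
  simp
  ring

/-- The primitive of `rubelBump`, a smooth increasing step. -/
noncomputable def rubelStep (x : ℝ) : ℝ := ∫ t in (-1)..x, rubelBump t

theorem hasDerivAt_rubelStep (x : ℝ) : HasDerivAt rubelStep (rubelBump x) x :=
  (contDiff_rubelBump.continuous.integral_hasStrictDerivAt (-1) x).hasDerivAt

theorem contDiff_rubelStep : ContDiff ℝ (⊤ : ℕ∞) rubelStep := by
  rw [contDiff_infty_iff_deriv]
  refine ⟨fun x => (hasDerivAt_rubelStep x).differentiableAt, ?_⟩
  rw [show deriv rubelStep = rubelBump from funext fun x => (hasDerivAt_rubelStep x).deriv]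
  exact contDiff_rubelBump

theorem monotone_rubelStep : Monotone rubelStep :=
  monotone_of_hasDerivAt_nonneg hasDerivAt_rubelStep rubelBump_nonneg

theorem rubelStep_of_le {x : ℝ} (hx : x ≤ -1) : rubelStep x = 0 := by
  rw [rubelStep, intervalIntegral.integral_symm,
    intervalIntegral.integral_congr (g := fun _ => 0), intervalIntegral.integral_zero, neg_zero]
  intro t ht
  rw [uIcc_of_le hx] at ht
  exact rubelBump_eq_zero (by nlinarith [ht.2])

theorem rubelStep_of_one_le {x : ℝ} (hx : 1 ≤ x) : rubelStep x = rubelStep 1 := by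
  have hint := fun a b => contDiff_rubelBump.continuous.intervalIntegrable a b
    (μ := MeasureTheory.volume)
  rw [rubelStep, ← intervalIntegral.integral_add_adjacent_intervals (hint (-1) 1) (hint 1 x),
    intervalIntegral.integral_congr (a := 1) (g := fun _ => 0), intervalIntegral.integral_zero,
    add_zero, rubelStep]
  intro t ht
  rw [uIcc_of_le hx] at ht
  exact rubelBump_eq_zero (by nlinarith [ht.1])

theorem rubelStep_one_pos : 0 < rubelStep 1 := by
  refine intervalIntegral.intervalIntegral_pos_of_pos_on
    (contDiff_rubelBump.continuous.intervalIntegrable _ _) (fun t ht => ?_) (by norm_num)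
  exact expNegInvGlue.pos_of_pos (by nlinarith [ht.1, ht.2])

theorem rubelStep_nonneg (x : ℝ) : 0 ≤ rubelStep x := by
  rcases le_total x (-1) with h | h
  · exact (rubelStep_of_le h).ge
  · exact (rubelStep_of_le le_rfl).ge.trans (monotone_rubelStep h)

theorem rubelStep_le (x : ℝ) : rubelStep x ≤ rubelStep 1 := by
  rcases le_total 1 x with h | h
  · exact (rubelStep_of_one_le h).le
  · exact monotone_rubelStep h

/-- A smooth solution of Rubel's equation equal to `A` up to `a` and to `B` from `b` on. -/
structure IsRubelTransition (V : ℝ → ℝ) (a b A B : ℝ) : Prop where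
  contDiff : ContDiff ℝ (⊤ : ℕ∞) V
  solves : ∀ x, SolvesRubelAt V x
  left : ∀ x ≤ a, V x = A
  right : ∀ x ≥ b, V x = B

theorem IsRubelTransition.iteratedDeriv_left {V : ℝ → ℝ} {a b A B : ℝ}
    (hV : IsRubelTransition V a b A B) (n : ℕ) {x : ℝ} (hx : x ≤ a) :
    iteratedDeriv (n + 1) V x = 0 :=
  iteratedDeriv_succ_eq_zero_of_mem_closure hV.contDiff isOpen_Iio
    (fun y hy => hV.left y (le_of_lt hy)) n (by rwa [closure_Iio])

theorem IsRubelTransition.iteratedDeriv_right {V : ℝ → ℝ} {a b A B : ℝ}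
    (hV : IsRubelTransition V a b A B) (n : ℕ) {x : ℝ} (hx : b ≤ x) :
    iteratedDeriv (n + 1) V x = 0 :=
  iteratedDeriv_succ_eq_zero_of_mem_closure hV.contDiff isOpen_Ioi
    (fun y hy => hV.right y (le_of_lt hy)) n (by rwa [closure_Ioi])

theorem isRubelTransition_const (a b A : ℝ) : IsRubelTransition (fun _ => A) a b A A where
  contDiff := contDiff_const
  solves x := solvesRubelAt_of_iteratedDeriv_eq_zero fun n => by simp [iteratedDeriv_const]
  left _ _ := rfl
  right _ _ := rfl

theorem IsRubelTransition.glue {V W : ℝ → ℝ} {a b c A B C : ℝ}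
    (hV : IsRubelTransition V a b A B) (hW : IsRubelTransition W b c B C)
    (hab : a ≤ b) (hbc : b ≤ c) :
    IsRubelTransition (fun x => V x + W x - B) a c A C where
  contDiff := (hV.contDiff.add hW.contDiff).sub contDiff_const
  solves x := by
    have hsum : ∀ n, iteratedDeriv (n + 1) (fun x => V x + W x - B) x =
        iteratedDeriv (n + 1) V x + iteratedDeriv (n + 1) W x := by
      intro n
      have hle : ((n + 1 : ℕ) : WithTop ℕ∞) ≤ ((⊤ : ℕ∞) : WithTop ℕ∞) := by exact_mod_cast le_top
      have hV' := (hV.contDiff.of_le hle).contDiffAt (x := x)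
      have hW' := (hW.contDiff.of_le hle).contDiffAt (x := x)
      rw [iteratedDeriv_fun_sub (hV'.add hW') contDiffAt_const, iteratedDeriv_fun_add hV' hW',
        iteratedDeriv_const]
      simp
    rcases le_total x b with h | h
    · exact (hV.solves x).congr fun n => by rw [hsum, hW.iteratedDeriv_left n h, add_zero]
    · exact (hW.solves x).congr fun n => by rw [hsum, hV.iteratedDeriv_right n h, zero_add]
  left x hx := by
    rw [hV.left x hx, hW.left x (hx.trans hab)]
    ring
  right x hx := by
    rw [hV.right x (hbc.trans hx), hW.right x hx]
    ring

theorem solvesRubelAt_rubelStep_affine (A k α β : ℝ) {x : ℝ} (hx : (α * x + β) ^ 2 < 1) :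
    SolvesRubelAt (fun y => A + k * rubelStep (α * y + β)) x := by
  have haff : ∀ y, HasDerivAt (fun y => α * y + β) α y := fun y => by
    simpa using ((hasDerivAt_id y).const_mul α).add_const β
  have hne : ∀ y, (α * y + β) ^ 2 < 1 → 1 - (α * y + β) ^ 2 ≠ 0 := fun y hy => by linarith
  have hq : ∀ y, HasDerivAt (fun y => 1 - (α * y + β) ^ 2) (-2 * α * (α * y + β)) y := fun y =>
    (((haff y).pow 2).const_sub 1).congr_deriv (by simp; ring)
  refine solvesRubelAt_of_hasDerivAt (s := {y | (α * y + β) ^ 2 < 1})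
    (D := fun y => k * α * rubelBump (α * y + β))
    (u := fun y => α * (-2 * (α * y + β) / (1 - (α * y + β) ^ 2) ^ 2))
    (u₁ := fun y => α ^ 2 * (-2 / (1 - (α * y + β) ^ 2) ^ 2
      - 8 * (α * y + β) ^ 2 / (1 - (α * y + β) ^ 2) ^ 3))
    (u₂ := fun y => α ^ 3 * (-24 * (α * y + β) / (1 - (α * y + β) ^ 2) ^ 3
      - 48 * (α * y + β) ^ 3 / (1 - (α * y + β) ^ 2) ^ 4))
    (isOpen_lt (by fun_prop) continuous_const) ?_ ?_ ?_ ?_ hx ?_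
  · intro y _
    exact ((((hasDerivAt_rubelStep _).comp y (haff y)).const_mul k).const_add A).congr_deriv
      (by ring)
  · intro y hy
    exact (((hasDerivAt_rubelBump hy).comp y (haff y)).const_mul (k * α)).congr_deriv (by ring)
  · intro y hy
    have := hne y hy
    refine ((((haff y).const_mul (-2)).fun_div ((hq y).fun_pow 2) (pow_ne_zero _ this)).const_mul
      α).congr_deriv ?_
    field_simp
    ring
  · intro y hy
    have := hne y hy
    refine ((((hasDerivAt_const y (-2)).fun_div ((hq y).fun_pow 2) (pow_ne_zero _ this)).fun_sub
      ((((haff y).fun_pow 2).const_mul 8).fun_div ((hq y).fun_pow 3)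
        (pow_ne_zero _ this))).const_mul (α ^ 2)).congr_deriv ?_
    field_simp
    ring
  · have := hne x hx
    generalize α * x + β = t at *
    field_simp
    ring

theorem exists_isRubelTransition {a b : ℝ} (hab : a < b) (A B : ℝ) :
    ∃ V, IsRubelTransition V a b A B ∧ ∀ x, V x ∈ uIcc A B := by
  have hd : 0 < b - a := sub_pos.2 hab
  have hc := rubelStep_one_pos
  obtain ⟨α, hα⟩ : ∃ α, α = 2 / (b - a) := ⟨_, rfl⟩
  obtain ⟨β, hβ⟩ : ∃ β, β = -(a + b) / (b - a) := ⟨_, rfl⟩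
  have hσ : ∀ x, α * x + β = (2 * x - a - b) / (b - a) := fun x => by rw [hα, hβ]; ring
  have hleft : ∀ x ≤ a, α * x + β ≤ -1 := fun x hx => by
    rw [hσ, div_le_iff₀ hd]; linarith
  have hright : ∀ x ≥ b, 1 ≤ α * x + β := fun x hx => by
    rw [hσ, le_div_iff₀ hd]; linarith
  have hsmooth : ContDiff ℝ (⊤ : ℕ∞)
      fun x => A + (B - A) / rubelStep 1 * rubelStep (α * x + β) :=
    contDiff_const.add (contDiff_const.mul (contDiff_rubelStep.comp (by fun_prop)))
  have hvl : ∀ x ≤ a, A + (B - A) / rubelStep 1 * rubelStep (α * x + β) = A := fun x hx => by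
    rw [rubelStep_of_le (hleft x hx)]; ring
  have hvr : ∀ x ≥ b, A + (B - A) / rubelStep 1 * rubelStep (α * x + β) = B := fun x hx => by
    rw [rubelStep_of_one_le (hright x hx)]; field_simp; ring
  refine ⟨fun x => A + (B - A) / rubelStep 1 * rubelStep (α * x + β),
    ⟨hsmooth, fun x => ?_, hvl, hvr⟩, fun x => ?_⟩
  · rcases le_or_gt x a with hxa | hxa
    · exact solvesRubelAt_of_iteratedDeriv_eq_zero fun n =>
        iteratedDeriv_succ_eq_zero_of_mem_closure hsmooth isOpen_Iio
          (fun y hy => hvl y (le_of_lt hy)) n (by rwa [closure_Iio])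
    rcases le_or_gt b x with hxb | hxb
    · exact solvesRubelAt_of_iteratedDeriv_eq_zero fun n =>
        iteratedDeriv_succ_eq_zero_of_mem_closure hsmooth isOpen_Ioi
          (fun y hy => hvr y (le_of_lt hy)) n (by rwa [closure_Ioi])
    refine solvesRubelAt_rubelStep_affine _ _ _ _ ?_
    rw [sq_lt_one_iff_abs_lt_one, abs_lt, hσ, lt_div_iff₀ hd, div_lt_iff₀ hd]
    constructor <;> linarith
  · have h := (convex_uIcc A B).add_smul_sub_mem left_mem_uIcc right_mem_uIcc
      (t := rubelStep (α * x + β) / rubelStep 1)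
      ⟨div_nonneg (rubelStep_nonneg _) hc.le, (div_le_one hc).2 (rubelStep_le _)⟩
    convert h using 1
    simp only [smul_eq_mul]
    ring

theorem exists_isRubelTransition_approx {f w : ℝ → ℝ} (hf : Continuous f) (hw : Continuous w)
    (hpos : ∀ x, 0 < w x) {a b : ℝ} (hab : a < b) :
    ∃ V, IsRubelTransition V a b (f a) (f b) ∧ ∀ x ∈ Icc a b, |f x - V x| ≤ w x := by
  obtain ⟨x₀, -, hx₀⟩ := isCompact_Icc.exists_isMinOn (nonempty_Icc.2 hab.le) hw.continuousOn
  have huc := isCompact_Icc.uniformContinuousOn_of_continuous (hf.continuousOn (s := Icc a b))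
  obtain ⟨δ, hδ, hfδ⟩ := Metric.uniformContinuousOn_iff_le.1 huc (w x₀) (hpos x₀)
  have hd : 0 < b - a := sub_pos.2 hab
  obtain ⟨N, hN⟩ := exists_nat_gt ((b - a) / δ)
  have hN0 : (0 : ℝ) < N := (div_pos hd hδ).trans hN
  have hstep : 0 < (b - a) / N := div_pos hd hN0
  have hstepδ : (b - a) / N ≤ δ := by
    rw [div_le_iff₀ hN0]
    rw [div_lt_iff₀ hδ] at hN
    linarith
  have key : ∀ k : ℕ, k ≤ N → ∃ V,
      IsRubelTransition V a (a + k * ((b - a) / N)) (f a) (f (a + k * ((b - a) / N))) ∧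
        ∀ x ∈ Icc a (a + k * ((b - a) / N)), |f x - V x| ≤ w x := by
    intro k
    induction k with
    | zero =>
      intro _
      refine ⟨fun _ => f a, by simpa using isRubelTransition_const a a (f a), fun x hx => ?_⟩
      obtain rfl : x = a := by simpa using hx
      simpa using (hpos x).le
    | succ k ih =>
      intro hk
      obtain ⟨V, hV, hVw⟩ := ih (by omega)
      have hkN : ((k + 1 : ℕ) : ℝ) ≤ N := by exact_mod_cast hk
      have hend : a + (k + 1 : ℕ) * ((b - a) / N) ≤ b := by
        have := mul_le_mul_of_nonneg_right hkN hstep.le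
        rw [mul_div_cancel₀ _ hN0.ne'] at this
        linarith
      have hsucc : a + (k + 1 : ℕ) * ((b - a) / N) = a + k * ((b - a) / N) + (b - a) / N := by
        push_cast; ring
      have hstart : a ≤ a + k * ((b - a) / N) := by
        have : 0 ≤ k * ((b - a) / N) := by positivity
        linarith
      generalize a + (k + 1 : ℕ) * ((b - a) / N) = d at *
      generalize a + k * ((b - a) / N) = c at *
      have hcd : c < d := by linarith
      obtain ⟨W, hW, hWm⟩ := exists_isRubelTransition hcd (f c) (f d)
      refine ⟨_, hV.glue hW hstart hcd.le, fun x hx => ?_⟩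
      rcases le_total x c with hxc | hxc
      · rw [hW.left x hxc, add_sub_cancel_right]
        exact hVw x ⟨hx.1, hxc⟩
      · rw [hV.right x hxc, add_sub_cancel_left]
        have hxI : x ∈ Icc a b := ⟨hx.1, hx.2.trans hend⟩
        have h1 := hfδ x hxI c ⟨hstart, hcd.le.trans hend⟩
          (by rw [Real.dist_eq, abs_le]; constructor <;> linarith [hx.2])
        have h2 := hfδ x hxI d ⟨hx.1.trans hx.2, hend⟩
          (by rw [Real.dist_eq, abs_le]; constructor <;> linarith [hx.2])
        have h3 := hx₀ hxI
        rw [mem_ofPred_eq] at h3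
        rw [Real.dist_eq, abs_le] at h1 h2
        rw [abs_le]
        rcases mem_uIcc.1 (hWm x) with h | h <;> constructor <;>
          linarith [h1.1, h1.2, h2.1, h2.2, h.1, h.2]
  obtain ⟨V, hV⟩ := key N le_rfl
  rw [mul_div_cancel₀ _ hN0.ne', add_sub_cancel] at hV
  exact ⟨V, hV⟩

/-- Rubel's theorem: there is a nonzero integer-coefficient polynomial `P` in five
variables such that the fourth-order ODE `P(U, U', U'', U''', U'''') = 0` has
`C^∞` solutions that approximate any continuous `f : ℝ → ℝ` within any continuous
positive weight `w`. -/
theorem rubel_universal_ode :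
    ∃ P : MvPolynomial (Fin 5) ℤ, P ≠ 0 ∧
      ∀ f w : ℝ → ℝ, Continuous f → Continuous w → (∀ x : ℝ, 0 < w x) →
        ∃ U : ℝ → ℝ, ContDiff ℝ (⊤ : ℕ∞) U ∧
          (∀ x : ℝ, MvPolynomial.aeval (fun i : Fin 5 => iteratedDeriv (i : ℕ) U x) P = 0) ∧
          (∀ x : ℝ, |f x - U x| ≤ w x) := by


  refine ⟨rubelPolynomial, rubelPolynomial_ne_zero, fun f w hf hw hpos => ?_⟩
  have hex := fun n : ℤ => exists_isRubelTransition_approx hf hw hpos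
    (show (n : ℝ) < ((n + 1 : ℤ) : ℝ) by push_cast; linarith)
  choose V hV hVw using hex
  have hlocal : ∀ x, ∃ W : ℝ → ℝ, (ContDiff ℝ (⊤ : ℕ∞) W ∧ ∀ y, SolvesRubelAt W y) ∧
      (fun y => V ⌊y⌋ y) =ᶠ[𝓝 x] W := by
    intro x
    obtain ⟨n, hn⟩ : ∃ n : ℤ, ⌊x⌋ = n + 1 := ⟨⌊x⌋ - 1, by ring⟩
    have hglue := (hV n).glue (hV (n + 1)) (by push_cast; linarith) (by push_cast; linarith)
    refine ⟨_, ⟨hglue.contDiff, hglue.solves⟩, ?_⟩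
    have hx := Int.floor_eq_iff.1 hn
    push_cast at hx
    filter_upwards [Ioo_mem_nhds (show (n : ℝ) < x by linarith) hx.2] with y hy
    rcases lt_or_ge y (n + 1) with h | h
    · have hfl : ⌊y⌋ = n := Int.floor_eq_iff.2 ⟨hy.1.le, h⟩
      rw [hfl, (hV (n + 1)).left y (by push_cast; exact h.le), add_sub_cancel_right]
    · have hfl : ⌊y⌋ = n + 1 := Int.floor_eq_iff.2 ⟨by push_cast; exact h, by
        push_cast; exact hy.2⟩
      rw [hfl, (hV n).right y (by push_cast; exact h), add_sub_cancel_left]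
  refine ⟨fun y => V ⌊y⌋ y, contDiff_iff_contDiffAt.2 fun x => ?_, fun x => ?_, fun x => ?_⟩
  · obtain ⟨W, hW, hev⟩ := hlocal x
    exact hW.1.contDiffAt.congr_of_eventuallyEq hev
  · obtain ⟨W, hW, hev⟩ := hlocal x
    exact (hW.2 x).congr_of_eventuallyEq hev
  · exact hVw ⌊x⌋ x ⟨Int.floor_le x, by push_cast; exact (Int.lt_floor_add_one x).le⟩
end

section
/- For every natural number n ≥ 2 there exist natural numbers m(n) and d(n) and a nonzero polynomial P with real coefficients, of total degree at most d(n), in the variables indexed by the partial derivatives D^p U with p ∈ ℕⁿ, |p| ≤ m(n), such that: for every continuous function f : [0,1]ⁿ → ℝ and every ε > 0 there exists a function U : ℝⁿ → ℝ that is infinitely differentiable on a neighbourhood of [0,1]ⁿ, satisfies the polynomial nonlinear PDE P(U(x), …, D^p U(x), …) = 0 for all x ∈ [0,1]ⁿ, and satisfies |f(x) − U(x)| ≤ ε for all x ∈ [0,1]ⁿ. -/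
/-- The partial derivative in the `i`-th coordinate direction of `ℝⁿ`. -/
noncomputable def pder {n : ℕ} (i : Fin n) (u : (Fin n → ℝ) → ℝ) :
    (Fin n → ℝ) → ℝ :=
  fun x => fderiv ℝ u x (Pi.single i 1)

/-- The multi-index partial derivative `D^p u` for a multi-index `p ∈ ℕⁿ`. -/
noncomputable def multiDeriv {n : ℕ} (p : Fin n → ℕ) (u : (Fin n → ℝ) → ℝ) :
    (Fin n → ℝ) → ℝ :=
  ((List.ofFn fun i : Fin n => (pder i)^[p i]).foldr (· ∘ ·) id) u

/-- A finite linear combination of tensor products of the univariate derivatives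
`(g k j)^{(e j)}`. -/
noncomputable def tensorSum {n : ℕ} {ι : Type*} (s : Finset ι) (c : ι → ℝ)
    (g : ι → Fin n → ℝ → ℝ) (e : Fin n → ℕ) (x : Fin n → ℝ) : ℝ :=
  ∑ k ∈ s, c k * ∏ j, iteratedDeriv (e j) (g k j) (x j)

section TensorSum

variable {n : ℕ} {ι : Type*} (s : Finset ι) (c : ι → ℝ) {g : ι → Fin n → ℝ → ℝ}

theorem pder_tensorSum (hg : ∀ k j, ContDiff ℝ (⊤ : ℕ∞) (g k j)) (e : Fin n → ℕ) (i : Fin n) :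
    pder i (tensorSum s c g e) = tensorSum s c g (e + Pi.single i 1) := by
  funext x
  have hd : ∀ k j, HasFDerivAt (fun y : Fin n → ℝ => iteratedDeriv (e j) (g k j) (y j))
      (iteratedDeriv (e j + 1) (g k j) (x j) • ContinuousLinearMap.proj (R := ℝ) j) x := by
    intro k j
    have h1 : HasDerivAt (iteratedDeriv (e j) (g k j))
        (iteratedDeriv (e j + 1) (g k j) (x j)) (x j) := by
      rw [iteratedDeriv_succ]
      exact (((hg k j).differentiable_iteratedDeriv (e j)
        (by exact_mod_cast WithTop.coe_lt_top _)) (x j)).hasDerivAt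
    exact h1.comp_hasFDerivAt (f := fun y : Fin n → ℝ => y j) x (hasFDerivAt_apply j x)
  have hp := HasFDerivAt.fun_sum (u := s) fun k _ =>
    (HasFDerivAt.finsetProd (u := Finset.univ) fun j _ => hd k j).const_mul (c k)
  have : fderiv ℝ (tensorSum s c g e) x = _ := hp.fderiv
  simp only [pder, this, sum_apply, smul_apply,
    ContinuousLinearMap.proj_apply, smul_eq_mul, tensorSum]
  refine Finset.sum_congr rfl fun k _ => ?_
  rw [Finset.sum_eq_single i (fun j _ hj => by simp [Pi.single_eq_of_ne hj]) (by simp)]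
  rw [← Finset.mul_prod_erase Finset.univ _ (Finset.mem_univ i), Pi.single_eq_same]
  have : ∏ j ∈ Finset.univ.erase i, iteratedDeriv ((e + Pi.single i 1 : Fin n → ℕ) j) (g k j) (x j) =
      ∏ j ∈ Finset.univ.erase i, iteratedDeriv (e j) (g k j) (x j) :=
    Finset.prod_congr rfl fun j hj => by simp [Pi.single_eq_of_ne (Finset.ne_of_mem_erase hj)]
  rw [this]
  simp only [Pi.add_apply, Pi.single_eq_same]
  ring

theorem iterate_pder_tensorSum (hg : ∀ k j, ContDiff ℝ (⊤ : ℕ∞) (g k j)) (e : Fin n → ℕ)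
    (i : Fin n) (m : ℕ) :
    (pder i)^[m] (tensorSum s c g e) = tensorSum s c g (e + Pi.single i m) := by
  induction m with
  | zero => simp
  | succ m ih =>
    rw [Function.iterate_succ_apply', ih, pder_tensorSum s c hg, add_assoc, ← Pi.single_add]

theorem multiDeriv_tensorSum (hg : ∀ k j, ContDiff ℝ (⊤ : ℕ∞) (g k j)) (p : Fin n → ℕ) :
    multiDeriv p (tensorSum s c g 0) = tensorSum s c g p := by
  have key : ∀ l : List (Fin n),
      ((l.map fun i => (pder i)^[p i]).foldr (· ∘ ·) id) (tensorSum s c g 0) =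
        tensorSum s c g (l.map fun i => Pi.single i (p i)).sum := by
    intro l
    induction l with
    | nil => simp
    | cons i l ih =>
      simp only [List.map_cons, List.foldr_cons, Function.comp_apply, List.sum_cons]
      rw [ih, iterate_pder_tensorSum s c hg, add_comm]
  have h := key (List.finRange n)
  rw [← List.ofFn_eq_map, ← List.ofFn_eq_map, List.sum_ofFn, Finset.univ_sum_single] at h
  exact h

theorem contDiff_tensorSum_zero (hg : ∀ k j, ContDiff ℝ (⊤ : ℕ∞) (g k j)) :
    ContDiff ℝ (⊤ : ℕ∞) (tensorSum s c g 0) := by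
  unfold tensorSum
  refine ContDiff.sum fun k _ => contDiff_const.mul (contDiff_prod fun j _ => ?_)
  simp only [Pi.zero_apply, iteratedDeriv_zero]
  exact (hg k j).comp (contDiff_apply ℝ ℝ j)

/-- If the jets `(g k j)^{(a)}`, `a = 1, 2`, at a point span a line as `k` varies, then the
mixed derivatives of the tensor sum satisfy a determinantal identity. -/
theorem tensorSum_mixed_det {u v : Fin n} (huv : u ≠ v) (x : Fin n → ℝ)
    (hr : ∀ j, ∃ (l : ι → ℝ) (r : ℕ → ℝ), ∀ k, ∀ a, 1 ≤ a →
      iteratedDeriv a (g k j) (x j) = l k * r a) :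
    tensorSum s c g (Pi.single u 1 + Pi.single v 1) x *
        tensorSum s c g (Pi.single u 2 + Pi.single v 2) x =
      tensorSum s c g (Pi.single u 2 + Pi.single v 1) x *
        tensorSum s c g (Pi.single u 1 + Pi.single v 2) x := by
  choose l r h using hr
  have key : ∀ a b, 1 ≤ a → 1 ≤ b → tensorSum s c g (Pi.single u a + Pi.single v b) x =
      (∑ k ∈ s, c k * (l u k * (l v k * ∏ j ∈ (Finset.univ.erase u).erase v, g k j (x j)))) *
        (r u a * r v b) := by
    intro a b ha hb
    rw [tensorSum, Finset.sum_mul]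
    refine Finset.sum_congr rfl fun k _ => ?_
    rw [← Finset.mul_prod_erase Finset.univ _ (Finset.mem_univ u),
      ← Finset.mul_prod_erase (Finset.univ.erase u) _
        (Finset.mem_erase.2 ⟨huv.symm, Finset.mem_univ v⟩)]
    have : ∏ j ∈ (Finset.univ.erase u).erase v,
        iteratedDeriv ((Pi.single u a + Pi.single v b : Fin n → ℕ) j) (g k j) (x j) =
        ∏ j ∈ (Finset.univ.erase u).erase v, g k j (x j) := by
      refine Finset.prod_congr rfl fun j hj => ?_
      simp only [Finset.mem_erase] at hj
      simp [Pi.single_eq_of_ne hj.1, Pi.single_eq_of_ne hj.2.1]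
    rw [this]
    simp only [Pi.add_apply, Pi.single_eq_same, Pi.single_eq_of_ne huv,
      Pi.single_eq_of_ne huv.symm, add_zero, zero_add, h u k a ha, h v k b hb]
    ring
  rw [key 1 1 le_rfl le_rfl, key 2 2 one_le_two one_le_two, key 2 1 one_le_two le_rfl,
    key 1 2 le_rfl one_le_two]
  ring

end TensorSum

theorem iteratedDeriv_smoothTransition_eq_zero {a : ℕ} (ha : 1 ≤ a) {t : ℝ}
    (ht : t ≤ 0 ∨ 1 ≤ t) : iteratedDeriv a Real.smoothTransition t = 0 := by
  have smooth : ContDiff ℝ (⊤ : ℕ∞) Real.smoothTransition := Real.smoothTransition.contDiff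
  have hd (a : ℕ) (t : ℝ) : HasDerivAt (iteratedDeriv a Real.smoothTransition)
      (iteratedDeriv (a + 1) Real.smoothTransition t) t := by
    rw [iteratedDeriv_succ]
    exact (smooth.differentiable_iteratedDeriv a
      (by exact_mod_cast WithTop.coe_lt_top _) t).hasDerivAt
  have left (a : ℕ) : ∀ t ≤ (0 : ℝ), iteratedDeriv a Real.smoothTransition t = 0 := by
    induction a with
    | zero => intro t ht; simpa using Real.smoothTransition.zero_of_nonpos ht
    | succ a ih =>
      intro t ht
      refine (uniqueDiffWithinAt_Iic t).eq_deriv _ (hd a t).hasDerivWithinAt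
        ((hasDerivWithinAt_const t _ (0 : ℝ)).congr (fun y hy => ih y (le_trans hy ht)) (ih t ht))
  have right (a : ℕ) : ∀ t, (1 : ℝ) ≤ t →
      iteratedDeriv a Real.smoothTransition t = if a = 0 then 1 else 0 := by
    induction a with
    | zero => intro t ht; simpa using Real.smoothTransition.one_of_one_le ht
    | succ a ih =>
      intro t ht
      rw [if_neg a.succ_ne_zero]
      exact (uniqueDiffWithinAt_Ici t).eq_deriv _ (hd a t).hasDerivWithinAt
        ((hasDerivWithinAt_const t _ _).congr (fun y hy => ih y (le_trans ht hy)) (ih t ht))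
  rcases ht with ht | ht
  · exact left a t ht
  · rw [right a t ht, if_neg (by lia)]

/-- A smooth bump around `k / N`; for `k = 0, …, N` these form a partition of unity
on `[0,1]`. -/
noncomputable def gridBump (N k : ℕ) (t : ℝ) : ℝ :=
  Real.smoothTransition (N * t - k + 1) - Real.smoothTransition (N * t - k)

theorem contDiff_gridBump (N k : ℕ) : ContDiff ℝ (⊤ : ℕ∞) (gridBump N k) := by
  unfold gridBump
  exact (Real.smoothTransition.contDiff.comp (by fun_prop)).sub
    (Real.smoothTransition.contDiff.comp (by fun_prop))

theorem gridBump_nonneg (N k : ℕ) (t : ℝ) : 0 ≤ gridBump N k t :=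
  sub_nonneg.2 (Real.smoothTransition.monotone (by linarith))

theorem sum_gridBump (N : ℕ) {t : ℝ} (h0 : 0 ≤ t) (h1 : t ≤ 1) :
    ∑ k ∈ Finset.range (N + 1), gridBump N k t = 1 := by
  have h := Finset.sum_range_sub' (fun k : ℕ => Real.smoothTransition (N * t - k + 1)) (N + 1)
  have e : ∀ k : ℕ, (N : ℝ) * t - ((k + 1 : ℕ) : ℝ) + 1 = N * t - k := by
    intro k; push_cast; ring
  simp only [e] at h
  have hN : (0 : ℝ) ≤ N := N.cast_nonneg
  rw [show (∑ k ∈ Finset.range (N + 1), gridBump N k t) = _ from h,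
    Real.smoothTransition.one_of_one_le (by push_cast; nlinarith),
    Real.smoothTransition.zero_of_nonpos (by nlinarith), sub_zero]

theorem abs_sub_lt_of_gridBump_ne_zero {N k : ℕ} (hN : 0 < N) {t : ℝ} (h : gridBump N k t ≠ 0) :
    |t - k / N| < 1 / N := by
  have hN' : (0 : ℝ) < N := Nat.cast_pos.2 hN
  have h1 : (k : ℝ) - 1 < N * t := by
    by_contra! hc
    refine h ?_
    rw [gridBump, Real.smoothTransition.zero_of_nonpos (by linarith),
      Real.smoothTransition.zero_of_nonpos (by linarith), sub_zero]
  have h2 : (N : ℝ) * t < k + 1 := by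
    by_contra! hc
    refine h ?_
    rw [gridBump, Real.smoothTransition.one_of_one_le (by linarith),
      Real.smoothTransition.one_of_one_le (by linarith), sub_self]
  have : t - k / N = (N * t - k) / N := by field_simp
  rw [this, abs_div, abs_of_pos hN', div_lt_div_iff_of_pos_right hN', abs_lt]
  constructor <;> linarith

theorem iteratedDeriv_gridBump (N k a : ℕ) (t : ℝ) :
    iteratedDeriv a (gridBump N k) t =
      N ^ a * iteratedDeriv a Real.smoothTransition (N * t - k + 1) -
        N ^ a * iteratedDeriv a Real.smoothTransition (N * t - k) := by
  have smooth : ContDiff ℝ a Real.smoothTransition := Real.smoothTransition.contDiff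
  have key (d : ℝ) : iteratedDeriv a (fun y : ℝ => Real.smoothTransition (N * y + d)) t =
      N ^ a * iteratedDeriv a Real.smoothTransition (N * t + d) := by
    have := congrFun (iteratedDeriv_comp_const_mul (n := a)
      (f := fun y => Real.smoothTransition (y + d)) (smooth.comp (by fun_prop)) (N : ℝ)) t
    rw [this, iteratedDeriv_comp_add_const]
  have hf : gridBump N k = fun y : ℝ => Real.smoothTransition (N * y + (1 - k)) -
      Real.smoothTransition (N * y + (-k)) := by
    funext y; unfold gridBump; ring_nf
  rw [hf, iteratedDeriv_fun_sub, key, key]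
  · ring_nf
  · exact (smooth.comp (by fun_prop)).contDiffAt
  · exact (smooth.comp (by fun_prop)).contDiffAt

/-- At each point at most one of the transitions composing the bumps is active, so the positive
order jets of the bumps are proportional. -/
theorem exists_iteratedDeriv_gridBump_eq_mul (N : ℕ) (t : ℝ) :
    ∃ (l : ℕ → ℝ) (r : ℕ → ℝ), ∀ k a, 1 ≤ a → iteratedDeriv a (gridBump N k) t = l k * r a := by
  set i := ⌊(N : ℝ) * t⌋ with hi
  have hz : ∀ (j : ℤ) (a : ℕ), 1 ≤ a → iteratedDeriv a Real.smoothTransition (N * t - j) =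
      (if j = i then 1 else 0) * iteratedDeriv a Real.smoothTransition (N * t - i) := by
    intro j a ha
    split_ifs with hj
    · rw [hj, one_mul]
    rw [zero_mul]
    apply iteratedDeriv_smoothTransition_eq_zero ha
    rcases lt_or_gt_of_ne hj with hj | hj
    · right
      have h1 : (j : ℝ) + 1 ≤ i := by exact_mod_cast hj
      linarith [Int.floor_le ((N : ℝ) * t)]
    · left
      have h1 : (i : ℝ) + 1 ≤ j := by exact_mod_cast hj
      linarith [Int.lt_floor_add_one ((N : ℝ) * t)]
  refine ⟨fun k => (if (k : ℤ) - 1 = i then 1 else 0) - (if (k : ℤ) = i then 1 else 0),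
    fun a => N ^ a * iteratedDeriv a Real.smoothTransition (N * t - i), fun k a ha => ?_⟩
  have h1 := hz (k - 1) a ha
  have h2 := hz k a ha
  rw [show (N : ℝ) * t - ((k - 1 : ℤ) : ℝ) = N * t - k + 1 by push_cast; ring] at h1
  rw [Int.cast_natCast] at h2
  rw [iteratedDeriv_gridBump, h1, h2]
  ring

/-- A smooth quasi-interpolant on the grid of mesh `1 / N` approximates a continuous function. -/
theorem exists_tensorSum_gridBump_approx {n : ℕ} {f : (Fin n → ℝ) → ℝ}
    (hf : ContinuousOn f (Set.Icc 0 1)) {ε : ℝ} (hε : 0 < ε) :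
    ∃ (N : ℕ) (s : Finset (Fin n → ℕ)) (c : (Fin n → ℕ) → ℝ), ∀ x ∈ Set.Icc (0 : Fin n → ℝ) 1,
      |f x - tensorSum s c (fun k j => gridBump N (k j)) 0 x| ≤ ε := by
  obtain ⟨δ, hδ, hfδ⟩ := Metric.uniformContinuousOn_iff.1
    (isCompact_Icc.uniformContinuousOn_of_continuous hf) ε hε
  obtain ⟨M, hM⟩ := exists_nat_one_div_lt hδ
  set N := M + 1 with hN
  have hNpos : (0 : ℝ) < N := by positivity
  let s : Finset (Fin n → ℕ) := Fintype.piFinset fun _ => Finset.range (N + 1)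
  refine ⟨N, s, fun k => f fun j => (k j : ℝ) / N, fun x hx => ?_⟩
  have hsum : ∑ k ∈ s, ∏ j, gridBump N (k j) (x j) = 1 := by
    rw [← Finset.prod_univ_sum (fun _ => Finset.range (N + 1)) fun j k => gridBump N k (x j)]
    exact Finset.prod_eq_one fun j _ => sum_gridBump N (hx.1 j) (hx.2 j)
  have hsplit : f x - tensorSum s (fun k => f fun j => (k j : ℝ) / N)
      (fun k j => gridBump N (k j)) 0 x =
      ∑ k ∈ s, (f x - f fun j => (k j : ℝ) / N) * ∏ j, gridBump N (k j) (x j) := by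
    simp only [tensorSum, sub_mul, Finset.sum_sub_distrib, ← Finset.mul_sum, hsum, mul_one,
      Pi.zero_apply, iteratedDeriv_zero]
  rw [hsplit]
  calc |∑ k ∈ s, (f x - f fun j => (k j : ℝ) / N) * ∏ j, gridBump N (k j) (x j)|
      ≤ ∑ k ∈ s, |(f x - f fun j => (k j : ℝ) / N) * ∏ j, gridBump N (k j) (x j)| :=
        Finset.abs_sum_le_sum_abs _ _
    _ ≤ ∑ k ∈ s, ε * ∏ j, gridBump N (k j) (x j) := by
        refine Finset.sum_le_sum fun k hk => ?_
        have hw : 0 ≤ ∏ j, gridBump N (k j) (x j) :=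
          Finset.prod_nonneg fun j _ => gridBump_nonneg _ _ _
        rw [abs_mul, abs_of_nonneg hw]
        rcases hw.eq_or_lt with h0 | hpos
        · rw [← h0, mul_zero, mul_zero]
        refine mul_le_mul_of_nonneg_right (le_of_lt ?_) hw
        rw [← Real.dist_eq]
        refine hfδ x hx _ ⟨fun j => ?_, fun j => ?_⟩ ((dist_pi_lt_iff hδ).2 fun j => ?_)
        · simp only [Pi.zero_apply]; positivity
        · have := Finset.mem_range.1 (Fintype.mem_piFinset.1 hk j)
          simp only [Pi.one_apply]
          rw [div_le_one hNpos]
          exact_mod_cast Nat.lt_succ_iff.1 this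
        · rw [Real.dist_eq]
          refine (abs_sub_lt_of_gridBump_ne_zero M.succ_pos
            (Finset.prod_ne_zero_iff.1 hpos.ne' j (Finset.mem_univ j))).trans ?_
          simpa [hN] using hM
    _ = ε := by rw [← Finset.mul_sum, hsum, mul_one]

/-- Buck's theorem: for each `n ≥ 2` there are `m n`, `d n` and a nonzero real
polynomial `P` of total degree at most `d n` in the variables indexed by the partial
derivatives `D^p U`, `|p| ≤ m n`, such that the PDE `P(U, …, D^p U, …) = 0` has
solutions, `C^∞`-smooth on a neighbourhood of the cube `[0,1]ⁿ`, approximating any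
continuous `f` on `[0,1]ⁿ` uniformly within any `ε > 0`. -/
theorem buck_universal_pde (n : ℕ) (hn : 2 ≤ n) :
    ∃ (m d : ℕ) (P : MvPolynomial {p : Fin n → ℕ // (∑ i, p i) ≤ m} ℝ),
      P ≠ 0 ∧ P.totalDegree ≤ d ∧
      ∀ f : (Fin n → ℝ) → ℝ, ContinuousOn f (Set.Icc 0 1) →
        ∀ ε : ℝ, 0 < ε →
          ∃ U : (Fin n → ℝ) → ℝ,
            (∃ V : Set (Fin n → ℝ), IsOpen V ∧ Set.Icc 0 1 ⊆ V ∧ ContDiffOn ℝ (⊤ : ℕ∞) U V) ∧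
            (∀ x ∈ Set.Icc (0 : Fin n → ℝ) 1,
              MvPolynomial.eval
                (fun q : {p : Fin n → ℕ // (∑ i, p i) ≤ m} => multiDeriv q.1 U x) P = 0) ∧
            (∀ x ∈ Set.Icc (0 : Fin n → ℝ) 1, |f x - U x| ≤ ε) := by
  classical
  let u : Fin n := ⟨0, by lia⟩
  let v : Fin n := ⟨1, by lia⟩
  have huv : u ≠ v := by simp [u, v]
  let q (a b : Fin 3) : {p : Fin n → ℕ // (∑ i, p i) ≤ 4} :=
    ⟨Pi.single u (a : ℕ) + Pi.single v (b : ℕ), by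
      simp only [Pi.add_apply, Finset.sum_add_distrib, Finset.sum_pi_single', Finset.mem_univ,
        if_true]
      lia⟩
  have hq : ∀ a b a' b', q a b = q a' b' → a = a' ∧ b = b' := by
    intro a b a' b' h
    have hp := congrArg Subtype.val h
    have h1 := congrFun hp u
    have h2 := congrFun hp v
    simp only [q, Pi.add_apply, Pi.single_eq_same, Pi.single_eq_of_ne huv,
      Pi.single_eq_of_ne huv.symm, add_zero, zero_add] at h1 h2
    exact ⟨Fin.ext h1, Fin.ext h2⟩
  let P : MvPolynomial {p : Fin n → ℕ // (∑ i, p i) ≤ 4} ℝ :=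
    MvPolynomial.X (q 1 1) * MvPolynomial.X (q 2 2) -
      MvPolynomial.X (q 2 1) * MvPolynomial.X (q 1 2)
  refine ⟨4, P.totalDegree, P, fun hP => ?_, le_rfl, fun f hf ε hε => ?_⟩
  · have h := congrArg (MvPolynomial.eval fun z => if z = q 2 1 then (0 : ℝ) else 1) hP
    have h1 : q 1 1 ≠ q 2 1 := fun h => absurd (hq _ _ _ _ h).1 (by decide)
    have h2 : q 2 2 ≠ q 2 1 := fun h => absurd (hq _ _ _ _ h).2 (by decide)
    simp [P, h1, h2] at h
  · obtain ⟨N, s, c, happrox⟩ := exists_tensorSum_gridBump_approx hf hε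
    have hg : ∀ (k : Fin n → ℕ) (j : Fin n), ContDiff ℝ (⊤ : ℕ∞) (gridBump N (k j)) :=
      fun k j => contDiff_gridBump N (k j)
    refine ⟨_, ⟨Set.univ, isOpen_univ, Set.subset_univ _,
      (contDiff_tensorSum_zero s c hg).contDiffOn⟩, fun x _ => ?_, happrox⟩
    simp only [P, map_sub, map_mul, MvPolynomial.eval_X, multiDeriv_tensorSum s c hg]
    refine sub_eq_zero.2 (tensorSum_mixed_det s c huv x fun j => ?_)
    obtain ⟨l, r, h⟩ := exists_iteratedDeriv_gridBump_eq_mul N (x j)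
    exact ⟨fun k => l (k j), r, fun k => h (k j)⟩
end
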